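/- Let A be a symmetric N×N real matrix with nonnegative entries, let Φ : Fin N → Fin n be any map, and define the contracted matrix B by B(j,k) = ∑_{i, i' : Φ(i)=j, Φ(i')=k} A(i,i'). Write d_A(i) = ∑_{i'} A(i,i') and d_B(j) = ∑_k B(j,k). Suppose λ is a real number such that for every f : Fin N → ℝ with ∑_i f(i)·d_A(i) = 0 one has ∑_{i,i'} f(i)·A(i,i')·f(i') ≤ λ · ∑_i f(i)²·d_A(i). Then for every g : Fin n → ℝ with ∑_j g(j)·d_B(j) = 0 one has ∑_{j,k} g(j)·B(j,k)·g(k) ≤ λ · ∑_j g(j)²·d_B(j). -/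

import Mathlib

open Finset

/-- Weighting each fibre of `φ` by a function of the base point. -/
theorem sum_mul_sum_fiber {ι κ R : Type*} [Fintype ι] [Fintype κ] [DecidableEq κ]
    [NonUnitalNonAssocSemiring R] (φ : ι → κ) (h : κ → R) (a : ι → R) :
    ∑ j, h j * ∑ i ∈ univ.filter (fun i => φ i = j), a i = ∑ i, h (φ i) * a i := by
  rw [← sum_fiberwise univ φ (fun i => h (φ i) * a i)]
  refine sum_congr rfl fun j _ => ?_
  rw [mul_sum]
  refine sum_congr rfl fun i hi => ?_
  rw [(mem_filter.mp hi).2]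

/-- Contracting the vertices of a weighted graph (symmetric nonnegative matrix `A`) along a
map `Φ` does not increase the Rayleigh-quotient bound `λ` on the second largest eigenvalue
of the degree-normalized adjacency matrix: if every `f` that is degree-orthogonal to the
constants has Rayleigh quotient at most `lam` for `A`, then the same holds for the
contracted matrix `B`. -/
theorem contraction_rayleigh_bound {N n : ℕ} (A : Matrix (Fin N) (Fin N) ℝ)
    (hsymm : ∀ i i', A i i' = A i' i) (hnonneg : ∀ i i', 0 ≤ A i i')
    (Φ : Fin N → Fin n) (B : Matrix (Fin n) (Fin n) ℝ)
    (hB : ∀ j k, B j k =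
      ∑ i ∈ univ.filter (fun i => Φ i = j), ∑ i' ∈ univ.filter (fun i' => Φ i' = k), A i i')
    (dA : Fin N → ℝ) (hdA : ∀ i, dA i = ∑ i', A i i')
    (dB : Fin n → ℝ) (hdB : ∀ j, dB j = ∑ k, B j k)
    (lam : ℝ)
    (hlam : ∀ f : Fin N → ℝ, (∑ i, f i * dA i) = 0 →
      (∑ i, ∑ i', f i * A i i' * f i') ≤ lam * ∑ i, (f i) ^ 2 * dA i) :
    ∀ g : Fin n → ℝ, (∑ j, g j * dB j) = 0 →
      (∑ j, ∑ k, g j * B j k * g k) ≤ lam * ∑ j, (g j) ^ 2 * dB j := by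
  intro g hg
  have hdeg : ∀ j, dB j = ∑ i ∈ univ.filter (fun i => Φ i = j), dA i := by
    intro j
    simp only [hdB, hB, hdA]
    rw [sum_comm]
    exact sum_congr rfl fun i _ => sum_fiberwise univ Φ (A i)
  have hquad : ∑ j, ∑ k, g j * B j k * g k = ∑ i, ∑ i', g (Φ i) * A i i' * g (Φ i') := by
    calc ∑ j, ∑ k, g j * B j k * g k
        = ∑ j, g j * ∑ i ∈ univ.filter (fun i => Φ i = j),
            ∑ k, g k * ∑ i' ∈ univ.filter (fun i' => Φ i' = k), A i i' := by
          refine sum_congr rfl fun j _ => ?_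
          rw [sum_comm, mul_sum]
          refine sum_congr rfl fun k _ => ?_
          rw [hB, ← mul_sum]
          ring
      _ = ∑ i, ∑ i', g (Φ i) * A i i' * g (Φ i') := by
          simp only [sum_mul_sum_fiber]
          simp only [mul_sum]
          exact sum_congr rfl fun i _ => sum_congr rfl fun i' _ => by ring
  simp only [hdeg] at hg ⊢
  rw [sum_mul_sum_fiber] at hg
  rw [hquad, sum_mul_sum_fiber Φ (fun j => g j ^ 2)]
  exact hlam (fun i => g (Φ i)) hg
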